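/- Let F be a field. For each composition α of n, let M_α be the F-subspace of the coinvariant algebra F[x_1,…,x_n]/(F[x]^{𝔖_n}_+) spanned by the images of {π̄_w(x_{D(α)}) : w ∈ 𝔖_n, D(w) = D(α)}. Then these images form an F-basis of M_α, each M_α is invariant under all the induced operators π̄_i, and the coinvariant algebra is the direct sum ⨁_{α ⊨ n} M_α over all compositions α of n. (Decomposition of Theorem 4.4.) -/

import Mathlib

open MvPolynomial

/-- Value of a permutation of `Fin n` as a function `ℕ → ℕ` (0 outside range). -/
def pval {n : ℕ} (w : Equiv.Perm (Fin n)) (i : ℕ) : ℕ :=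
  if h : i < n then (w ⟨i, h⟩ : ℕ) else 0

/-- 0-based descent set of `w`: `i ∈ permDes w` iff `w(i) > w(i+1)`, `0 ≤ i ≤ n-2`.
(This corresponds to the 1-based descent `i+1` of the paper.) -/
def permDes {n : ℕ} (w : Equiv.Perm (Fin n)) : Finset ℕ :=
  (Finset.range (n - 1)).filter fun i => pval w (i + 1) < pval w i

/-- Number of inversions = Coxeter length of `w`. -/
def invNum {n : ℕ} (w : Equiv.Perm (Fin n)) : ℕ :=
  (Finset.univ.filter fun p : Fin n × Fin n => p.1 < p.2 ∧ w p.2 < w p.1).card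

/-- The simple transposition `s_i = (i, i+1)` (0-based); identity if out of range. -/
def sw (n : ℕ) (i : ℕ) : Equiv.Perm (Fin n) :=
  if h : i + 1 < n then Equiv.swap ⟨i, Nat.lt_of_succ_lt h⟩ ⟨i + 1, h⟩ else 1

/-- Exponent vector of `x_I = ∏_{i ∈ I} (x_0 x_1 ⋯ x_i)`. -/
def expI (n : ℕ) (I : Finset ℕ) : Fin n → ℕ := fun j => (I.filter fun i => (j : ℕ) ≤ i).card

/-- The monomial `x_I = ∏_{i ∈ I} (x_0 x_1 ⋯ x_i)`. -/
noncomputable def xI (R : Type*) [CommRing R] (n : ℕ) (I : Finset ℕ) :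
    MvPolynomial (Fin n) R :=
  ∏ j : Fin n, (X j) ^ expI n I j

/-- `λ(d)`: the decreasing rearrangement of an exponent vector. -/
def lam {n : ℕ} (d : Fin n → ℕ) : List ℕ := (List.ofFn d).insertionSort (· ≥ ·)

/-- `x^d ≺ x^e` : `λ(d)` lexicographically smaller than `λ(e)`. -/
def monLT {n : ℕ} (d e : Fin n → ℕ) : Prop := List.Lex (· < ·) (lam d) (lam e)

/-- 0-based descent set `D(α)` of a composition `α` of `n`:
`{α_1 + ⋯ + α_j - 1 : 1 ≤ j ≤ ℓ(α) - 1}` (0-based shift of the paper's `D(α)`). -/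
def compDes {n : ℕ} (c : Composition n) : Finset ℕ :=
  (Finset.range (c.length - 1)).image fun j => c.sizeUpTo (j + 1) - 1

/-- The ideal of `F[x]` generated by the symmetric (`𝔖_n`-invariant) polynomials with zero
constant term; the coinvariant algebra is the quotient by this ideal. -/
noncomputable def coinvIdeal (n : ℕ) (F : Type*) [Field F] : Ideal (MvPolynomial (Fin n) F) :=
  Ideal.span {f : MvPolynomial (Fin n) F | f.IsSymmetric ∧ constantCoeff f = 0}

section AtomOperators

variable {n : ℕ} {F : Type*} [Field F]

theorem sw_apply_val {i : ℕ} (hi : i + 1 < n) (a : Fin n) :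
    (sw n i a : ℕ) = if (a : ℕ) = i then i + 1 else if (a : ℕ) = i + 1 then i else a := by
  rw [sw, dif_pos hi, Equiv.swap_apply_def]
  simp only [Fin.ext_iff]
  split_ifs <;> rfl

theorem sw_mul_self (n i : ℕ) : sw n i * sw n i = 1 := by
  rw [sw]; split_ifs <;> simp

theorem sw_mul_sw_mul (i : ℕ) (w : Equiv.Perm (Fin n)) : sw n i * (sw n i * w) = w := by
  rw [← mul_assoc, sw_mul_self, one_mul]

theorem sw_inv (n i : ℕ) : (sw n i)⁻¹ = sw n i :=
  inv_eq_of_mul_eq_one_left (sw_mul_self n i)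

theorem sw_symm_apply (i : ℕ) (a : Fin n) : (sw n i).symm a = sw n i a := by
  rw [← Equiv.Perm.inv_def, sw_inv]

theorem sw_sw_apply (i : ℕ) (a : Fin n) : sw n i (sw n i a) = a := by
  rw [← Equiv.Perm.mul_apply, sw_mul_self, Equiv.Perm.one_apply]

theorem sw_commute {i j : ℕ} (hi : i + 1 < n) (hj : j + 1 < n) (h : i + 1 < j) :
    sw n i * sw n j = sw n j * sw n i := by
  ext a
  simp only [Equiv.Perm.mul_apply, sw_apply_val hi, sw_apply_val hj]
  split_ifs <;> omega

theorem sw_braid {i : ℕ} (hi : i + 1 + 1 < n) :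
    sw n i * (sw n (i + 1) * sw n i) = sw n (i + 1) * (sw n i * sw n (i + 1)) := by
  have hi' : i + 1 < n := by omega
  ext a
  simp only [Equiv.Perm.mul_apply, sw_apply_val hi, sw_apply_val hi']
  split_ifs <;> omega

/-- `T` is the family of operators `π̄_i`, that is
`(x_i - x_{i+1}) T_i f = x_{i+1} (f - s_i f)`. -/
def IsAtomOperator (T : ℕ → MvPolynomial (Fin n) F → MvPolynomial (Fin n) F) : Prop :=
  ∀ (i : ℕ) (hi : i + 1 < n) (f : MvPolynomial (Fin n) F),
    (X (⟨i, Nat.lt_of_succ_lt hi⟩ : Fin n) - X ⟨i + 1, hi⟩) * T i f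
      = X ⟨i + 1, hi⟩ * (f - rename (sw n i) f)

theorem X_sub_X_ne_zero {a b : Fin n} (h : a ≠ b) :
    (X a - X b : MvPolynomial (Fin n) F) ≠ 0 :=
  sub_ne_zero.2 fun e => h (X_injective e)

theorem X_sub_X_succ_ne_zero {i : ℕ} (hi : i + 1 < n) :
    (X (⟨i, Nat.lt_of_succ_lt hi⟩ : Fin n) - X ⟨i + 1, hi⟩ : MvPolynomial (Fin n) F) ≠ 0 :=
  X_sub_X_ne_zero (by simp)

theorem rename_sw_rename_sw (i : ℕ) (f : MvPolynomial (Fin n) F) :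
    rename (sw n i) (rename (sw n i) f) = f := by
  rw [rename_rename, ← Equiv.Perm.coe_mul, sw_mul_self, Equiv.Perm.coe_one, rename_id_apply]

theorem rename_sw_X_self {i : ℕ} (hi : i + 1 < n) :
    rename (sw n i) (X ⟨i, Nat.lt_of_succ_lt hi⟩ : MvPolynomial (Fin n) F) = X ⟨i + 1, hi⟩ := by
  rw [rename_X]; congr 1; ext; simp [sw_apply_val hi]

theorem rename_sw_X_succ {i : ℕ} (hi : i + 1 < n) :
    rename (sw n i) (X ⟨i + 1, hi⟩ : MvPolynomial (Fin n) F)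
      = X ⟨i, Nat.lt_of_succ_lt hi⟩ := by
  rw [rename_X]; congr 1; ext; simp [sw_apply_val hi]

theorem rename_sw_X_of_ne {i j : ℕ} (hi : i + 1 < n) (hj : j < n) (h : j ≠ i) (h' : j ≠ i + 1) :
    rename (sw n i) (X ⟨j, hj⟩ : MvPolynomial (Fin n) F) = X ⟨j, hj⟩ := by
  rw [rename_X]; congr 1; ext; simp [sw_apply_val hi, h, h']

namespace IsAtomOperator

variable {T : ℕ → MvPolynomial (Fin n) F → MvPolynomial (Fin n) F}

theorem eq_of_mul (hT : IsAtomOperator T) {i : ℕ} (hi : i + 1 < n) {f g : MvPolynomial (Fin n) F}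
    (h : (X (⟨i, Nat.lt_of_succ_lt hi⟩ : Fin n) - X ⟨i + 1, hi⟩) * g
      = X ⟨i + 1, hi⟩ * (f - rename (sw n i) f)) : T i f = g :=
  mul_left_cancel₀ (X_sub_X_succ_ne_zero hi) ((hT i hi f).trans h.symm)

theorem map_add (hT : IsAtomOperator T) {i : ℕ} (hi : i + 1 < n) (f g : MvPolynomial (Fin n) F) :
    T i (f + g) = T i f + T i g := by
  refine hT.eq_of_mul hi ?_
  rw [mul_add, hT i hi, hT i hi, _root_.map_add]
  ring

theorem map_mul (hT : IsAtomOperator T) {i : ℕ} (hi : i + 1 < n) {s : MvPolynomial (Fin n) F}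
    (hs : rename (sw n i) s = s) (f : MvPolynomial (Fin n) F) :
    T i (s * f) = s * T i f := by
  refine hT.eq_of_mul hi ?_
  rw [mul_left_comm, hT i hi, _root_.map_mul, hs]
  ring

theorem map_smul (hT : IsAtomOperator T) {i : ℕ} (hi : i + 1 < n) (c : F)
    (f : MvPolynomial (Fin n) F) : T i (c • f) = c • T i f := by
  rw [smul_eq_C_mul, smul_eq_C_mul, hT.map_mul hi (rename_C _ _)]

/-- An atom operator as a linear map. -/
def toLinearMap (hT : IsAtomOperator T) {i : ℕ} (hi : i + 1 < n) :
    MvPolynomial (Fin n) F →ₗ[F] MvPolynomial (Fin n) F where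
  toFun := T i
  map_add' := hT.map_add hi
  map_smul' := hT.map_smul hi

theorem apply_eq_zero (hT : IsAtomOperator T) {i : ℕ} (hi : i + 1 < n)
    {f : MvPolynomial (Fin n) F} (hf : rename (sw n i) f = f) : T i f = 0 :=
  hT.eq_of_mul hi (by rw [hf]; ring)

theorem apply_rename (hT : IsAtomOperator T) {i : ℕ} (hi : i + 1 < n)
    (f : MvPolynomial (Fin n) F) : T i (rename (sw n i) f) = - T i f := by
  refine hT.eq_of_mul hi ?_
  rw [rename_sw_rename_sw, mul_neg, hT i hi]
  ring

theorem apply_apply (hT : IsAtomOperator T) {i : ℕ} (hi : i + 1 < n)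
    (f : MvPolynomial (Fin n) F) : T i (T i f) = - T i f := by
  refine hT.eq_of_mul hi ?_
  have h := hT i hi f
  have h' := congrArg (rename (sw n i)) h
  simp only [_root_.map_mul, _root_.map_sub, rename_sw_rename_sw, rename_sw_X_self hi,
    rename_sw_X_succ hi] at h'
  have h2 : rename (sw n i) (T i f) - T i f = f - rename (sw n i) f :=
    mul_left_cancel₀ (X_sub_X_succ_ne_zero hi) (by linear_combination -h' - h)
  linear_combination (X ⟨i + 1, hi⟩ : MvPolynomial (Fin n) F) * h2 - h

theorem comm (hT : IsAtomOperator T) {i j : ℕ} (hi : i + 1 < n) (hj : j + 1 < n) (h : i + 1 < j)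
    (f : MvPolynomial (Fin n) F) : T i (T j f) = T j (T i f) := by
  have hij : rename (sw n i) (rename (sw n j) f) = rename (sw n j) (rename (sw n i) f) := by
    rw [rename_rename, rename_rename, ← Equiv.Perm.coe_mul, ← Equiv.Perm.coe_mul,
      sw_commute hi hj h]
  have e1 := congrArg (rename (sw n i)) (hT j hj f)
  have e2 := congrArg (rename (sw n j)) (hT i hi f)
  simp only [_root_.map_mul, _root_.map_sub, hij,
    rename_sw_X_of_ne hi (show j < n by omega) (by omega) (by omega),
    rename_sw_X_of_ne hi hj (by omega) (by omega),
    rename_sw_X_of_ne hj (show i < n by omega) (by omega) (by omega),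
    rename_sw_X_of_ne hj hi (by omega) (by omega)] at e1 e2
  have e3 := hT j hj f
  have e4 := hT i hi f
  have e5 := hT i hi (T j f)
  have e6 := hT j hj (T i f)
  refine mul_left_cancel₀ (X_sub_X_succ_ne_zero hi) <|
    mul_left_cancel₀ (X_sub_X_succ_ne_zero hj) ?_
  set x : MvPolynomial (Fin n) F := X ⟨i, Nat.lt_of_succ_lt hi⟩
  set y : MvPolynomial (Fin n) F := X ⟨i + 1, hi⟩
  set z : MvPolynomial (Fin n) F := X ⟨j, Nat.lt_of_succ_lt hj⟩
  set t : MvPolynomial (Fin n) F := X ⟨j + 1, hj⟩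
  linear_combination (z - t) * e5 - (x - y) * e6 + y * e3 - y * e1 - t * e4 + t * e2

theorem braid (hT : IsAtomOperator T) {i : ℕ} (hj : i + 1 + 1 < n)
    (f : MvPolynomial (Fin n) F) :
    T i (T (i + 1) (T i f)) = T (i + 1) (T i (T (i + 1) f)) := by
  have hi : i + 1 < n := by omega
  have hs : rename (sw n i) (rename (sw n (i + 1)) (rename (sw n i) f))
      = rename (sw n (i + 1)) (rename (sw n i) (rename (sw n (i + 1)) f)) := by
    simp only [rename_rename, ← Equiv.Perm.coe_mul, ← mul_assoc]
    rw [mul_assoc, sw_braid hj, ← mul_assoc]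
  have r1 := rename_sw_X_self (F := F) hi
  have r2 := rename_sw_X_succ (F := F) hi
  have r3 := rename_sw_X_of_ne (F := F) hi hj (by omega) (by omega)
  have r4 := rename_sw_X_self (F := F) hj
  have r5 := rename_sw_X_succ (F := F) hj
  have r6 := rename_sw_X_of_ne (F := F) hj (show i < n by omega) (by omega) (by omega)
  have a1 := hT i hi f
  have a2 := hT (i + 1) hj (T i f)
  have a3 := hT i hi (T (i + 1) (T i f))
  have a4 := congrArg (rename (sw n (i + 1))) a1
  have a5 := congrArg (rename (sw n i)) a2
  have a6 := congrArg (rename (sw n i)) a1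
  have a7 := congrArg (rename (sw n i)) a4
  have b1 := hT (i + 1) hj f
  have b2 := hT i hi (T (i + 1) f)
  have b3 := hT (i + 1) hj (T i (T (i + 1) f))
  have b4 := congrArg (rename (sw n i)) b1
  have b5 := congrArg (rename (sw n (i + 1))) b2
  have b6 := congrArg (rename (sw n (i + 1))) b1
  have b7 := congrArg (rename (sw n (i + 1))) b4
  simp only [_root_.map_mul, _root_.map_sub, r1, r2, r3, r4, r5, r6, rename_sw_rename_sw, hs]
    at a4 a5 a6 a7 b4 b5 b6 b7
  have hxz : (X (⟨i, by omega⟩ : Fin n) - X ⟨i + 1 + 1, hj⟩ : MvPolynomial (Fin n) F) ≠ 0 :=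
    X_sub_X_ne_zero (by rw [Ne, Fin.mk.injEq]; omega)
  refine mul_left_cancel₀ (X_sub_X_succ_ne_zero hi) <| mul_left_cancel₀ (X_sub_X_succ_ne_zero hj) <|
    mul_left_cancel₀ hxz <| mul_left_cancel₀ (X_sub_X_succ_ne_zero hi) <|
    mul_left_cancel₀ (X_sub_X_succ_ne_zero hj) ?_
  set x : MvPolynomial (Fin n) F := X ⟨i, Nat.lt_of_succ_lt hi⟩
  set y : MvPolynomial (Fin n) F := X ⟨i + 1, hi⟩
  set z : MvPolynomial (Fin n) F := X ⟨i + 1 + 1, hj⟩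
  linear_combination (y - z) * (a3 * (x - y) * (y - z) * (x - z) + a2 * y * (x - y) * (x - z)
      - a5 * y * (x - y) * (y - z) + a1 * y * z * (x - z) - a4 * y * z * (x - y)
      + a6 * y * z * (y - z) + a7 * y * z * (x - y))
    - (x - y) * (b3 * (x - y) * (y - z) * (x - z) + b2 * z * (y - z) * (x - z)
      - b5 * z * (x - y) * (y - z) + b1 * y * z * (x - z) - b4 * y * z * (y - z)
      + b6 * z * z * (x - y) + b7 * z * z * (y - z))

end IsAtomOperator

end AtomOperators

section ReducedWords

variable {n : ℕ}

theorem exists_succ_lt_of_lt {α : Type*} [LinearOrder α] {f : Fin n → α} {p q : Fin n}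
    (hpq : p ≤ q) (h : f q < f p) :
    ∃ (k : ℕ) (hk : k + 1 < n), (p : ℕ) ≤ k ∧ k + 1 ≤ (q : ℕ) ∧
      f ⟨k + 1, hk⟩ < f ⟨k, Nat.lt_of_succ_lt hk⟩ := by
  obtain ⟨q, hq⟩ := q
  obtain ⟨m, rfl⟩ := Nat.exists_eq_add_of_le (show (p : ℕ) ≤ q from hpq)
  clear hpq
  induction m with
  | zero => exact absurd h (lt_irrefl _)
  | succ m ih =>
    by_cases h' : f ⟨p + (m + 1), hq⟩ < f ⟨p + m, by omega⟩
    · exact ⟨p + m, hq, by omega, le_rfl, h'⟩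
    · obtain ⟨k, hk, h1, h2, h3⟩ := ih (by omega) ((not_lt.1 h').trans_lt h)
      exact ⟨k, hk, h1, by simp only at h2 ⊢; omega, h3⟩

theorem symm_sw_mul (i : ℕ) (w : Equiv.Perm (Fin n)) (a : Fin n) :
    (sw n i * w).symm a = w.symm (sw n i a) := by
  rw [Equiv.symm_apply_eq, Equiv.Perm.mul_apply, Equiv.apply_symm_apply, sw_sw_apply]

theorem sw_apply_self {i : ℕ} (hi : i + 1 < n) :
    sw n i ⟨i, Nat.lt_of_succ_lt hi⟩ = ⟨i + 1, hi⟩ := by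
  ext; simp [sw_apply_val hi]

theorem sw_apply_succ {i : ℕ} (hi : i + 1 < n) :
    sw n i ⟨i + 1, hi⟩ = ⟨i, Nat.lt_of_succ_lt hi⟩ := by
  ext; simp [sw_apply_val hi]

theorem sw_apply_of_ne {i j : ℕ} (hi : i + 1 < n) (hj : j < n) (h : j ≠ i) (h' : j ≠ i + 1) :
    sw n i ⟨j, hj⟩ = ⟨j, hj⟩ := by
  ext; simp [sw_apply_val hi, h, h']

/-- `i` is a left ascent of `w`: the value `i` occurs before the value `i + 1`. -/
def IsLeftAscent (w : Equiv.Perm (Fin n)) {i : ℕ} (hi : i + 1 < n) : Prop :=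
  w.symm ⟨i, Nat.lt_of_succ_lt hi⟩ < w.symm ⟨i + 1, hi⟩

theorem isLeftAscent_sw_mul_iff {i : ℕ} (hi : i + 1 < n) (w : Equiv.Perm (Fin n)) :
    IsLeftAscent (sw n i * w) hi ↔ ¬ IsLeftAscent w hi := by
  rw [IsLeftAscent, IsLeftAscent, symm_sw_mul, symm_sw_mul, sw_apply_self, sw_apply_succ, not_lt,
    le_iff_lt_or_eq, or_iff_left]
  intro h
  simpa using w.symm.injective h

theorem sw_mul_lt_iff {i : ℕ} {hi : i + 1 < n} {w : Equiv.Perm (Fin n)}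
    (h : IsLeftAscent w hi) {p q : Fin n} (hpq : p < q) :
    (sw n i * w) q < (sw n i * w) p ↔
      (p = w.symm ⟨i, Nat.lt_of_succ_lt hi⟩ ∧ q = w.symm ⟨i + 1, hi⟩) ∨ w q < w p := by
  have h1 : ¬ (q = w.symm ⟨i, Nat.lt_of_succ_lt hi⟩ ∧ p = w.symm ⟨i + 1, hi⟩) := by
    rintro ⟨rfl, rfl⟩
    exact lt_asymm h hpq
  have h2 : w p ≠ w q := fun e => hpq.ne (w.injective e)
  simp only [Equiv.eq_symm_apply, Fin.ext_iff, Fin.lt_def, Equiv.Perm.mul_apply, sw_apply_val hi,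
    ne_eq] at h1 h2 ⊢
  split_ifs <;> omega

theorem invNum_sw_mul {i : ℕ} {hi : i + 1 < n} {w : Equiv.Perm (Fin n)}
    (h : IsLeftAscent w hi) : invNum (sw n i * w) = invNum w + 1 := by
  have h0 : (w.symm ⟨i, Nat.lt_of_succ_lt hi⟩, w.symm ⟨i + 1, hi⟩) ∉
      Finset.univ.filter fun p : Fin n × Fin n => p.1 < p.2 ∧ w p.2 < w p.1 := by
    simp
  rw [invNum, invNum, ← Finset.card_insert_of_notMem h0]
  congr 1
  ext ⟨p, q⟩
  simp only [Finset.mem_filter, Finset.mem_univ, true_and, Finset.mem_insert, Prod.mk.injEq]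
  constructor
  · rintro ⟨hpq, h'⟩
    rw [sw_mul_lt_iff h hpq] at h'
    tauto
  · rintro (⟨rfl, rfl⟩ | ⟨hpq, h'⟩)
    · exact ⟨h, (sw_mul_lt_iff h h).2 (Or.inl ⟨rfl, rfl⟩)⟩
    · exact ⟨hpq, (sw_mul_lt_iff h hpq).2 (Or.inr h')⟩

theorem invNum_sw_mul_add_one {i : ℕ} {hi : i + 1 < n} {w : Equiv.Perm (Fin n)}
    (h : ¬ IsLeftAscent w hi) : invNum (sw n i * w) + 1 = invNum w := by
  rw [← invNum_sw_mul ((isLeftAscent_sw_mul_iff hi w).2 h), sw_mul_sw_mul]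

theorem invNum_one : invNum (1 : Equiv.Perm (Fin n)) = 0 := by
  rw [invNum, Finset.card_eq_zero, Finset.filter_eq_empty_iff]
  rintro ⟨p, q⟩ - ⟨h, h'⟩
  exact lt_asymm h h'

theorem invNum_prod_le (l : List ℕ) (hl : ∀ i ∈ l, i + 1 < n) :
    invNum (l.map (sw n)).prod ≤ l.length := by
  induction l with
  | nil => simp [invNum_one]
  | cons i l ih =>
    have hi := hl i (by simp)
    have := ih fun j hj => hl j (by simp [hj])
    rw [List.map_cons, List.prod_cons, List.length_cons]
    by_cases h : IsLeftAscent (l.map (sw n)).prod hi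
    · rw [invNum_sw_mul h]; omega
    · have := invNum_sw_mul_add_one h; omega

/-- `l` is a reduced word of `w`. -/
structure IsReducedWord (l : List ℕ) (w : Equiv.Perm (Fin n)) : Prop where
  lt : ∀ i ∈ l, i + 1 < n
  prod_eq : (l.map (sw n)).prod = w
  length_eq : l.length = invNum w

namespace IsReducedWord

variable {l : List ℕ} {w : Equiv.Perm (Fin n)} {i : ℕ}

theorem cons {hi : i + 1 < n} (h : IsReducedWord l w) (ha : IsLeftAscent w hi) :
    IsReducedWord (i :: l) (sw n i * w) where
  lt := by simpa using ⟨hi, h.lt⟩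
  prod_eq := by simp [h.prod_eq]
  length_eq := by rw [List.length_cons, h.length_eq, invNum_sw_mul ha]

theorem cons' {hi : i + 1 < n} (h : IsReducedWord l (sw n i * w)) (ha : ¬ IsLeftAscent w hi) :
    IsReducedWord (i :: l) w := by
  simpa only [sw_mul_sw_mul] using h.cons ((isLeftAscent_sw_mul_iff hi w).2 ha)

theorem not_isLeftAscent (h : IsReducedWord (i :: l) w) :
    ¬ IsLeftAscent w (h.lt i (by simp)) := by
  intro ha
  have h1 := invNum_sw_mul ha
  have h2 := h.length_eq
  have h3 := invNum_prod_le l fun j hj => h.lt j (by simp [hj])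
  rw [← h.prod_eq, List.map_cons, List.prod_cons, sw_mul_sw_mul] at h1
  rw [← h.prod_eq, List.map_cons, List.prod_cons, List.length_cons] at h2
  omega

theorem of_cons (h : IsReducedWord (i :: l) w) : IsReducedWord l (sw n i * w) where
  lt j hj := h.lt j (by simp [hj])
  prod_eq := by rw [← h.prod_eq, List.map_cons, List.prod_cons, sw_mul_sw_mul]
  length_eq := by
    have h1 := invNum_sw_mul_add_one h.not_isLeftAscent
    have h2 := h.length_eq
    rw [List.length_cons] at h2
    omega

theorem eq_one_of_forall_isLeftAscent
    (h : ∀ (i : ℕ) (hi : i + 1 < n), IsLeftAscent w hi) : w = 1 := by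
  have hm : Monotone w.symm := by
    intro p q hpq
    by_contra! hlt
    obtain ⟨k, hk, -, -, h'⟩ := exists_succ_lt_of_lt hpq hlt
    exact lt_asymm h' (h k hk)
  have := (Equiv.Perm.monotone_iff _).1 hm
  rw [← Equiv.symm_symm w, this]
  rfl

theorem exists_word (w : Equiv.Perm (Fin n)) : ∃ l, IsReducedWord l w := by
  induction hm : invNum w generalizing w with
  | zero =>
    refine ⟨[], by simp, ?_, hm.symm⟩
    refine (eq_one_of_forall_isLeftAscent fun i hi => ?_).symm
    by_contra h
    have := invNum_sw_mul_add_one h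
    omega
  | succ m ih =>
    by_cases h : ∃ (i : ℕ) (hi : i + 1 < n), ¬ IsLeftAscent w hi
    · obtain ⟨i, hi, h⟩ := h
      obtain ⟨l, hl⟩ := ih (sw n i * w) (by have := invNum_sw_mul_add_one h; omega)
      exact ⟨i :: l, hl.cons' h⟩
    · push Not at h
      rw [eq_one_of_forall_isLeftAscent h, invNum_one] at hm
      omega

end IsReducedWord

theorem IsAtomOperator.foldr_eq {F : Type*} [Field F]
    {T : ℕ → MvPolynomial (Fin n) F → MvPolynomial (Fin n) F} (hT : IsAtomOperator T)
    {l l' : List ℕ} {w : Equiv.Perm (Fin n)} (hl : IsReducedWord l w) (hl' : IsReducedWord l' w)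
    (f : MvPolynomial (Fin n) F) : l.foldr T f = l'.foldr T f := by
  induction hm : l.length using Nat.strong_induction_on generalizing l l' w with
  | _ m ih =>
  have hlen : l.length = l'.length := hl.length_eq.trans hl'.length_eq.symm
  match l, l' with
  | [], [] => rfl
  | [], j :: v => simp at hlen
  | i :: u, [] => simp at hlen
  | i :: u, j :: v =>
    wlog hij : i ≤ j generalizing i u j v
    · exact (this j v i u hl' hl (by rw [← hlen, hm]) hlen.symm (by omega)).symm
    have hi : i + 1 < n := hl.lt i (by simp)
    have hj : j + 1 < n := hl'.lt j (by simp)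
    have hai : ¬ IsLeftAscent w hi := hl.not_isLeftAscent
    have haj : ¬ IsLeftAscent w hj := hl'.not_isLeftAscent
    have hu := hl.of_cons
    have hv := hl'.of_cons
    simp only [List.length_cons] at hm hlen
    simp only [List.foldr_cons]
    rcases hij.eq_or_lt with rfl | hij
    · rw [ih u.length (by omega) hu hv rfl]
    rcases Nat.lt_or_ge (i + 1) j with hij' | hij'
    · obtain ⟨t, ht⟩ := IsReducedWord.exists_word (sw n j * (sw n i * w))
      have h1 : IsReducedWord (j :: t) (sw n i * w) := by
        refine ht.cons' (hi := hj) ?_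
        rwa [IsLeftAscent, symm_sw_mul, symm_sw_mul,
          sw_apply_of_ne hi _ (by omega) (by omega), sw_apply_of_ne hi _ (by omega) (by omega)]
      have h2 : IsReducedWord (i :: t) (sw n j * w) := by
        rw [← mul_assoc, ← sw_commute hi hj hij', mul_assoc] at ht
        refine ht.cons' (hi := hi) ?_
        rwa [IsLeftAscent, symm_sw_mul, symm_sw_mul,
          sw_apply_of_ne hj _ (by omega) (by omega), sw_apply_of_ne hj _ (by omega) (by omega)]
      rw [ih u.length (by omega) hu h1 rfl, ih v.length (by omega) hv h2 rfl]
      exact hT.comm hi hj hij' _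
    · obtain rfl : j = i + 1 := by omega
      have hbraid : sw n i * (sw n (i + 1) * (sw n i * w))
          = sw n (i + 1) * (sw n i * (sw n (i + 1) * w)) := by
        simp only [← mul_assoc]
        rw [mul_assoc (sw n i), sw_braid hj, ← mul_assoc]
      have hi2 : i ≠ i + 1 + 1 := by omega
      obtain ⟨t, ht⟩ := IsReducedWord.exists_word (sw n i * (sw n (i + 1) * (sw n i * w)))
      have ht' := ht
      rw [hbraid] at ht'
      have hac : w.symm ⟨i + 1 + 1, hj⟩ < w.symm ⟨i, by omega⟩ := by
        rw [IsLeftAscent, not_lt] at hai haj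
        refine lt_of_le_of_ne (haj.trans hai) fun e => ?_
        exact hi2 (by simpa using (w.symm.injective e).symm)
      have h1 : IsReducedWord ((i + 1) :: i :: t) (sw n i * w) := by
        refine (ht.cons' (hi := hi) ?_).cons' (hi := hj) ?_
        · simpa only [IsLeftAscent, symm_sw_mul, sw_apply_self hi, sw_apply_succ hi,
            sw_apply_of_ne hj (show i < n by omega) (by omega) (by omega), sw_apply_self hj,
            sw_apply_of_ne hi hj (by omega) (by omega)] using haj
        · simpa only [IsLeftAscent, symm_sw_mul, sw_apply_succ hi,
            sw_apply_of_ne hi hj (by omega) (by omega), not_lt] using hac.le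
      have h2 : IsReducedWord (i :: (i + 1) :: t) (sw n (i + 1) * w) := by
        refine (ht'.cons' (hi := hj) ?_).cons' (hi := hi) ?_
        · simpa only [IsLeftAscent, symm_sw_mul, sw_apply_self hj, sw_apply_succ hj,
            sw_apply_of_ne hj (show i < n by omega) (by omega) (by omega), sw_apply_succ hi,
            sw_apply_of_ne hi hj (by omega) (by omega)] using hai
        · simpa only [IsLeftAscent, symm_sw_mul, sw_apply_self hj,
            sw_apply_of_ne hj (show i < n by omega) (by omega) (by omega), not_lt] using hac.le
      rw [ih u.length (by omega) hu h1 rfl, ih v.length (by omega) hv h2 rfl]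
      exact hT.braid hj _

end ReducedWords

section Monomials

variable {n : ℕ} (F : Type*) [Field F]

/-- The monomial with exponent vector `d`. -/
noncomputable def monom (d : Fin n → ℕ) : MvPolynomial (Fin n) F := ∏ j, X j ^ d j

/-- The monomials as a basis indexed by exponent vectors. -/
noncomputable def monomBasis (n : ℕ) : Module.Basis (Fin n → ℕ) F (MvPolynomial (Fin n) F) :=
  (basisMonomials (Fin n) F).reindex Finsupp.equivFunOnFinite

theorem monomBasis_apply (d : Fin n → ℕ) : monomBasis F n d = monom F d := by
  rw [monomBasis, Module.Basis.reindex_apply, coe_basisMonomials]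
  simp only [monomial_eq, C_1, one_mul]
  rw [Finsupp.prod_fintype _ _ (by simp), monom]
  rfl

theorem monom_add (d e : Fin n → ℕ) : monom F (d + e) = monom F d * monom F e := by
  simp only [monom, Pi.add_apply, pow_add, Finset.prod_mul_distrib]

theorem monom_single (i : Fin n) : monom F (Pi.single i 1) = X i := by
  rw [monom, Finset.prod_eq_single i (fun j _ hj => by simp [hj]) (by simp), Pi.single_eq_same,
    pow_one]

theorem monom_zero : monom F (0 : Fin n → ℕ) = 1 := by simp [monom]

theorem rename_monom (σ : Equiv.Perm (Fin n)) (d : Fin n → ℕ) :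
    rename σ (monom F d) = monom F (d ∘ σ.symm) := by
  simp only [monom, map_prod, map_pow, rename_X, Function.comp_apply]
  rw [← Equiv.prod_comp σ fun j => X j ^ d (σ.symm j)]
  simp

/-- `∑_{p, q} max (d_p, d_q)`, a permutation-invariant strictly convex measure of how unbalanced
the exponent vector `d` is. -/
def maxSum (d : Fin n → ℕ) : ℕ := ∑ p : Fin n × Fin n, max (d p.1) (d p.2)

theorem maxSum_comp_perm (d : Fin n → ℕ) (σ : Equiv.Perm (Fin n)) :
    maxSum (d ∘ σ) = maxSum d :=
  Equiv.sum_comp (σ.prodCongr σ) fun p : Fin n × Fin n => max (d p.1) (d p.2)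

theorem maxSum_add_le (d e : Fin n → ℕ) : maxSum (d + e) ≤ maxSum d + maxSum e := by
  rw [maxSum, maxSum, maxSum, ← Finset.sum_add_distrib]
  refine Finset.sum_le_sum fun p _ => ?_
  simp only [Pi.add_apply]
  omega

theorem maxSum_add_lt {d e : Fin n → ℕ} {p q : Fin n} (h : d p < d q) (h' : e q < e p) :
    maxSum (d + e) < maxSum d + maxSum e := by
  rw [maxSum, maxSum, maxSum, ← Finset.sum_add_distrib]
  refine Finset.sum_lt_sum (fun r _ => ?_) ⟨(p, q), Finset.mem_univ _, ?_⟩ <;>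
  · simp only [Pi.add_apply]
    omega

theorem maxSum_add_of_monovary {d e : Fin n → ℕ} (h : Monovary d e) :
    maxSum (d + e) = maxSum d + maxSum e := by
  rw [maxSum, maxSum, maxSum, ← Finset.sum_add_distrib]
  refine Finset.sum_congr rfl fun r _ => ?_
  have h1 := @h r.1 r.2
  have h2 := @h r.2 r.1
  simp only [Pi.add_apply]
  omega

theorem maxSum_lt_of_convex {d d' : Fin n → ℕ} {σ : Equiv.Perm (Fin n)} {s t : ℕ} (hs : 0 < s)
    (ht : 0 < t) (h : ∀ p, (s + t) * d' p = s * d p + t * d (σ p)) {p q : Fin n}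
    (hpq : d p < d q) (hqp : d (σ q) < d (σ p)) : maxSum d' < maxSum d := by
  refine lt_of_mul_lt_mul_left (a := s + t) ?_ (Nat.zero_le _)
  have h1 : (s + t) * maxSum d = s * maxSum d + t * maxSum (d ∘ σ) := by
    rw [maxSum_comp_perm, add_mul]
  rw [h1]
  simp only [maxSum, Finset.mul_sum]
  rw [← Finset.sum_add_distrib]
  refine Finset.sum_lt_sum (fun r _ => ?_) ⟨(p, q), Finset.mem_univ _, ?_⟩
  · simp only [← Nat.mul_max_mul_left, h, Function.comp_apply]
    omega
  · simp only [← Nat.mul_max_mul_left, h, Function.comp_apply]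
    have h2 := Nat.mul_lt_mul_of_pos_left hpq hs
    have h3 := Nat.mul_lt_mul_of_pos_left hqp ht
    omega

/-- The span of the monomials with `maxSum` less than `k`. -/
noncomputable def lowSpan (n k : ℕ) : Submodule F (MvPolynomial (Fin n) F) :=
  Submodule.span F (monom F '' {e | maxSum e < k})

variable {F}

theorem monom_mem_lowSpan {d : Fin n → ℕ} {k : ℕ} (h : maxSum d < k) : monom F d ∈ lowSpan F n k :=
  Submodule.subset_span ⟨d, h, rfl⟩

theorem lowSpan_mono {k k' : ℕ} (h : k ≤ k') : lowSpan F n k ≤ lowSpan F n k' :=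
  Submodule.span_mono (Set.image_mono fun _ he => lt_of_lt_of_le he h)

theorem monom_mul_mem_lowSpan {d : Fin n → ℕ} {k : ℕ} {f : MvPolynomial (Fin n) F}
    (hf : f ∈ lowSpan F n k) : monom F d * f ∈ lowSpan F n (maxSum d + k) := by
  have : lowSpan F n k ≤ (lowSpan F n (maxSum d + k)).comap (LinearMap.mulLeft F (monom F d)) := by
    rw [lowSpan, Submodule.span_le]
    rintro _ ⟨e, he, rfl⟩
    rw [SetLike.mem_coe, Submodule.mem_comap, LinearMap.mulLeft_apply, ← monom_add]
    exact monom_mem_lowSpan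
      ((maxSum_add_le d e).trans_lt (Nat.add_lt_add_left he _))
  exact this hf

/-- The exponent vector obtained from `d` by replacing its entries at `i` and `i + 1` by
`d_{i+1} + k` and `d_i - k`. -/
def shiftExp {i : ℕ} (hi : i + 1 < n) (d : Fin n → ℕ) (k : ℕ) : Fin n → ℕ := fun j =>
  if (j : ℕ) = i then d ⟨i + 1, hi⟩ + k
  else if (j : ℕ) = i + 1 then d ⟨i, Nat.lt_of_succ_lt hi⟩ - k else d j

theorem shiftExp_zero {i : ℕ} (hi : i + 1 < n) (d : Fin n → ℕ) :
    shiftExp hi d 0 = d ∘ sw n i := by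
  ext j
  rw [Function.comp_apply, shiftExp]
  split_ifs with h1 h2
  · obtain rfl : j = ⟨i, Nat.lt_of_succ_lt hi⟩ := Fin.ext h1
    rw [sw_apply_self hi, add_zero]
  · obtain rfl : j = ⟨i + 1, hi⟩ := Fin.ext h2
    rw [sw_apply_succ hi, Nat.sub_zero]
  · rw [show j = ⟨j, j.2⟩ from rfl, sw_apply_of_ne hi j.2 h1 h2]

theorem shiftExp_sub {i : ℕ} (hi : i + 1 < n) {d : Fin n → ℕ}
    (h : d ⟨i + 1, hi⟩ ≤ d ⟨i, Nat.lt_of_succ_lt hi⟩) :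
    shiftExp hi d (d ⟨i, Nat.lt_of_succ_lt hi⟩ - d ⟨i + 1, hi⟩) = d := by
  ext j
  rw [shiftExp]
  split_ifs with h1 h2
  · obtain rfl : j = ⟨i, Nat.lt_of_succ_lt hi⟩ := Fin.ext h1
    omega
  · obtain rfl : j = ⟨i + 1, hi⟩ := Fin.ext h2
    omega
  · rfl

theorem X_mul_monom_shiftExp {i : ℕ} (hi : i + 1 < n) {d : Fin n → ℕ} {k : ℕ}
    (hk : k < d ⟨i, Nat.lt_of_succ_lt hi⟩) :
    X ⟨i, Nat.lt_of_succ_lt hi⟩ * monom F (shiftExp hi d k)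
      = X ⟨i + 1, hi⟩ * monom F (shiftExp hi d (k + 1)) := by
  rw [← monom_single, ← monom_single, ← monom_add, ← monom_add]
  congr 1
  ext j
  simp only [Pi.add_apply, Pi.single_apply, shiftExp, Fin.ext_iff]
  split_ifs <;> omega

theorem maxSum_shiftExp_lt {i : ℕ} (hi : i + 1 < n) {d : Fin n → ℕ} {k : ℕ} (hk : 0 < k)
    (hk' : k < d ⟨i, Nat.lt_of_succ_lt hi⟩ - d ⟨i + 1, hi⟩) :
    maxSum (shiftExp hi d k) < maxSum d := by
  obtain ⟨t, ht⟩ := Nat.exists_eq_add_of_lt hk'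
  have hd : d ⟨i, Nat.lt_of_succ_lt hi⟩ = d ⟨i + 1, hi⟩ + (k + (t + 1)) := by omega
  refine maxSum_lt_of_convex (σ := sw n i) hk t.succ_pos (fun p => ?_)
    (p := ⟨i + 1, hi⟩) (q := ⟨i, Nat.lt_of_succ_lt hi⟩) (by omega)
    (by rw [sw_apply_self hi, sw_apply_succ hi]; omega)
  rw [shiftExp]
  split_ifs with h1 h2
  · obtain rfl : p = ⟨i, Nat.lt_of_succ_lt hi⟩ := Fin.ext h1
    rw [sw_apply_self hi, hd, Nat.succ_eq_add_one]
    ring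
  · obtain rfl : p = ⟨i + 1, hi⟩ := Fin.ext h2
    rw [sw_apply_succ hi, hd, Nat.succ_eq_add_one, show d ⟨i + 1, hi⟩ + (k + (t + 1)) - k
      = d ⟨i + 1, hi⟩ + (t + 1) by omega]
    ring
  · rw [show p = ⟨p, p.2⟩ from rfl, sw_apply_of_ne hi p.2 h1 h2, add_mul]

namespace IsAtomOperator

variable {T : ℕ → MvPolynomial (Fin n) F → MvPolynomial (Fin n) F}

theorem apply_monom (hT : IsAtomOperator T) {i : ℕ} (hi : i + 1 < n) {d : Fin n → ℕ}
    (h : d ⟨i + 1, hi⟩ ≤ d ⟨i, Nat.lt_of_succ_lt hi⟩) :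
    T i (monom F d) = ∑ k ∈ Finset.range (d ⟨i, Nat.lt_of_succ_lt hi⟩ - d ⟨i + 1, hi⟩),
      monom F (shiftExp hi d k) := by
  refine hT.eq_of_mul hi ?_
  rw [rename_monom, show (sw n i).symm = sw n i from sw_inv n i, ← shiftExp_zero hi]
  have hd := congrArg (monom F) (shiftExp_sub hi h)
  rw [← hd, ← Finset.sum_range_sub fun k => monom F (shiftExp hi d k), Finset.mul_sum, Finset.mul_sum]
  refine Finset.sum_congr rfl fun k hk => ?_
  rw [Finset.mem_range] at hk
  rw [sub_mul, X_mul_monom_shiftExp hi (by omega), mul_sub]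

theorem apply_monom_sub_mem (hT : IsAtomOperator T) {i : ℕ} (hi : i + 1 < n) {d : Fin n → ℕ}
    (h : d ⟨i + 1, hi⟩ < d ⟨i, Nat.lt_of_succ_lt hi⟩) :
    T i (monom F d) - monom F (d ∘ sw n i) ∈ lowSpan F n (maxSum d) := by
  obtain ⟨c, hc⟩ := Nat.exists_eq_add_of_lt h
  rw [hT.apply_monom hi h.le, show d ⟨i, Nat.lt_of_succ_lt hi⟩ - d ⟨i + 1, hi⟩ = c + 1 by omega,
    Finset.sum_range_succ', shiftExp_zero, add_sub_cancel_right]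
  refine Submodule.sum_mem _ fun k hk => monom_mem_lowSpan ?_
  rw [Finset.mem_range] at hk
  exact maxSum_shiftExp_lt hi k.succ_pos (by omega)

theorem apply_mem_lowSpan (hT : IsAtomOperator T) {i : ℕ} (hi : i + 1 < n) {k : ℕ}
    {f : MvPolynomial (Fin n) F} (hf : f ∈ lowSpan F n k) : T i f ∈ lowSpan F n k := by
  have hgt : ∀ d : Fin n → ℕ, maxSum d < k → d ⟨i + 1, hi⟩ < d ⟨i, Nat.lt_of_succ_lt hi⟩ →
      T i (monom F d) ∈ lowSpan F n k := fun d hd h => by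
    have h1 := lowSpan_mono hd.le (hT.apply_monom_sub_mem hi h)
    have h2 : monom F (d ∘ sw n i) ∈ lowSpan F n k :=
      monom_mem_lowSpan ((maxSum_comp_perm d _).trans_lt hd)
    simpa using add_mem h1 h2
  have : lowSpan F n k ≤ (lowSpan F n k).comap (hT.toLinearMap hi) := by
    conv_lhs => rw [lowSpan]
    rw [Submodule.span_le]
    rintro _ ⟨d, hd, rfl⟩
    replace hd : maxSum d < k := hd
    change T i (monom F d) ∈ lowSpan F n k
    rcases lt_trichotomy (d ⟨i, Nat.lt_of_succ_lt hi⟩) (d ⟨i + 1, hi⟩) with h | h | h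
    · rw [← neg_neg (T i _), ← hT.apply_rename hi, rename_monom,
        show (sw n i).symm = sw n i from sw_inv n i]
      refine neg_mem (hgt _ ((maxSum_comp_perm d _).trans_lt hd) ?_)
      simpa only [Function.comp_apply, sw_apply_self hi, sw_apply_succ hi] using h
    · rw [hT.apply_monom hi h.ge, h, Nat.sub_self, Finset.range_zero, Finset.sum_empty]
      exact zero_mem _
    · exact hgt d hd h
  exact this hf

theorem foldr_monom_sub_mem (hT : IsAtomOperator T) {l : List ℕ} {w : Equiv.Perm (Fin n)}
    (hl : IsReducedWord l w) {d : Fin n → ℕ} (hd : ∀ p q, p < q → w q < w p → d q < d p) :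
    l.foldr T (monom F d) - monom F (d ∘ w.symm) ∈ lowSpan F n (maxSum d) := by
  induction l generalizing w with
  | nil =>
    obtain rfl : 1 = w := hl.prod_eq
    have : d ∘ (1 : Equiv.Perm (Fin n)).symm = d := rfl
    rw [List.foldr_nil, this, sub_self]
    exact zero_mem _
  | cons i l ih =>
    have hi := hl.lt i (by simp)
    have ha : IsLeftAscent (sw n i * w) hi :=
      (isLeftAscent_sw_mul_iff hi w).2 hl.not_isLeftAscent
    have hlt : ∀ p q, p < q → (sw n i * w) q < (sw n i * w) p → w q < w p := fun p q hpq h => by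
      rw [← sw_mul_sw_mul i w]
      exact (sw_mul_lt_iff ha hpq).2 (Or.inr h)
    have h1 := hT.apply_mem_lowSpan hi
      (ih hl.of_cons fun p q hpq h => hd p q hpq (hlt p q hpq h))
    have h2 := hT.apply_monom_sub_mem hi (d := d ∘ (sw n i * w).symm) <| by
      refine hd _ _ ha ?_
      rw [symm_sw_mul, symm_sw_mul, sw_apply_self hi, sw_apply_succ hi, Equiv.apply_symm_apply,
        Equiv.apply_symm_apply]
      exact Nat.lt_succ_self i
    rw [maxSum_comp_perm] at h2
    have h3 : d ∘ (sw n i * w).symm ∘ sw n i = d ∘ w.symm := by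
      ext j
      simp only [Function.comp_apply, symm_sw_mul, sw_sw_apply]
    rw [Function.comp_assoc, h3] at h2
    have h4 : T i (l.foldr T (monom F d) - monom F (d ∘ (sw n i * w).symm))
        = T i (l.foldr T (monom F d)) - T i (monom F (d ∘ (sw n i * w).symm)) :=
      _root_.map_sub (hT.toLinearMap hi) _ _
    rw [h4] at h1
    simpa using add_mem h1 h2

end IsAtomOperator

end Monomials

section DescentExponents

variable {n : ℕ}

theorem mem_permDes {w : Equiv.Perm (Fin n)} {k : ℕ} :
    k ∈ permDes w ↔ ∃ hk : k + 1 < n, w ⟨k + 1, hk⟩ < w ⟨k, Nat.lt_of_succ_lt hk⟩ := by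
  rw [permDes, Finset.mem_filter, Finset.mem_range]
  constructor
  · rintro ⟨h, h'⟩
    have hk : k + 1 < n := by omega
    rw [pval, pval, dif_pos hk, dif_pos (Nat.lt_of_succ_lt hk)] at h'
    exact ⟨hk, h'⟩
  · rintro ⟨hk, h'⟩
    rw [pval, pval, dif_pos hk, dif_pos (Nat.lt_of_succ_lt hk)]
    exact ⟨by omega, h'⟩

theorem expI_antitone (I : Finset ℕ) : Antitone (expI n I) := fun _ _ hpq =>
  Finset.card_le_card <| Finset.monotone_filter_right I fun _ _ h => le_trans hpq h

theorem expI_succ (I : Finset ℕ) {k : ℕ} (hk : k + 1 < n) :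
    expI n I ⟨k, Nat.lt_of_succ_lt hk⟩ = expI n I ⟨k + 1, hk⟩ + if k ∈ I then 1 else 0 := by
  have h : (I.filter fun i => k ≤ i) = (I.filter fun i => k + 1 ≤ i) ∪ I.filter fun i => i = k := by
    ext i
    simp only [Finset.mem_filter, Finset.mem_union]
    rw [← and_or_left]
    exact and_congr_right fun _ => by omega
  have hd : Disjoint (I.filter fun i => k + 1 ≤ i) (I.filter fun i => i = k) := by
    rw [Finset.disjoint_filter]
    rintro i - h rfl
    exact Nat.not_succ_le_self _ h
  simp only [expI]
  rw [h, Finset.card_union_of_disjoint hd, Finset.filter_eq']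
  split_ifs <;> simp

theorem expI_permDes_lt {w : Equiv.Perm (Fin n)} {p q : Fin n} (hpq : p < q) (h : w q < w p) :
    expI n (permDes w) q < expI n (permDes w) p := by
  obtain ⟨k, hk, h1, h2, h3⟩ := exists_succ_lt_of_lt hpq.le h
  have h4 := expI_antitone (n := n) (permDes w) (show p ≤ ⟨k, Nat.lt_of_succ_lt hk⟩ from h1)
  have h5 := expI_antitone (n := n) (permDes w) (show ⟨k + 1, hk⟩ ≤ q from h2)
  have h6 := expI_succ (permDes w) hk
  rw [if_pos (mem_permDes.2 ⟨hk, h3⟩)] at h6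
  omega

/-- Pairs consisting of a partition (with at most `n` parts) and a permutation. -/
abbrev PartPerm (n : ℕ) : Type := {μ : Fin n → ℕ // Antitone μ} × Equiv.Perm (Fin n)

/-- The exponent vector `w · (λ(x_{D(w)}) + μ)`. -/
def PartPerm.exponent (x : PartPerm n) : Fin n → ℕ :=
  expI n (permDes x.2) ∘ x.2.symm + x.1.1 ∘ x.2.symm

theorem PartPerm.exponent_apply (x : PartPerm n) (p : Fin n) :
    x.exponent (x.2 p) = expI n (permDes x.2) p + x.1.1 p := by
  simp [exponent]

theorem PartPerm.snd_eq_sort (x : PartPerm n) :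
    x.2 = Tuple.sort (OrderDual.toDual ∘ x.exponent) := by
  have ha := expI_antitone (n := n) (permDes x.2)
  rw [Tuple.eq_sort_iff]
  refine ⟨fun p q hpq => ?_, fun p q hpq h => ?_⟩
  · simp only [Function.comp_apply, OrderDual.toDual_le_toDual, exponent_apply]
    exact add_le_add (ha hpq) (x.1.2 hpq)
  · simp only [Function.comp_apply, OrderDual.toDual_inj, exponent_apply] at h
    by_contra h'
    have h1 := expI_permDes_lt hpq
      (lt_of_le_of_ne (not_lt.1 h') fun e => hpq.ne' (x.2.injective e))
    have h2 := x.1.2 hpq.le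
    omega

theorem PartPerm.exponent_injective : Function.Injective (PartPerm.exponent (n := n)) := by
  intro x y h
  have hw : x.2 = y.2 := by rw [x.snd_eq_sort, y.snd_eq_sort, h]
  refine Prod.ext (Subtype.ext (funext fun p => ?_)) hw
  have h1 := x.exponent_apply p
  rw [h, hw, y.exponent_apply] at h1
  omega

theorem PartPerm.exponent_surjective : Function.Surjective (PartPerm.exponent (n := n)) := by
  intro d
  obtain ⟨hm, hs⟩ := Tuple.eq_sort_iff.1 (rfl : Tuple.sort (OrderDual.toDual ∘ d) = _)
  set w := Tuple.sort (OrderDual.toDual ∘ d)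
  set I := expI n (permDes w) with hI
  have key : ∀ p q : Fin n, p ≤ q → I p + d (w q) ≤ d (w p) + I q := by
    intro p q hpq
    by_contra! h
    obtain ⟨k, hk, -, -, h'⟩ := exists_succ_lt_of_lt (f := fun p => (I p : ℤ) - d (w p)) hpq
      (by omega)
    have h1 := expI_succ (permDes w) hk
    rw [← hI] at h1
    have hlt : (⟨k, Nat.lt_of_succ_lt hk⟩ : Fin n) < ⟨k + 1, hk⟩ := Nat.lt_succ_self k
    have h2 : d (w ⟨k + 1, hk⟩) ≤ d (w ⟨k, _⟩) := hm hlt.le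
    split_ifs at h1 with h3
    · obtain ⟨_, h3⟩ := mem_permDes.1 h3
      have h4 : d (w ⟨k, _⟩) ≠ d (w ⟨k + 1, hk⟩) := fun e => lt_asymm h3 (hs _ _ hlt e)
      omega
    · omega
  have hle : ∀ p, I p ≤ d (w p) := by
    intro p
    have hn : n - 1 < n := by have := p.2; omega
    have h1 := key p ⟨n - 1, hn⟩ (by rw [Fin.le_def]; have := p.2; dsimp only; omega)
    have h2 : I ⟨n - 1, hn⟩ = 0 := by
      rw [hI, expI, Finset.card_eq_zero, Finset.filter_eq_empty_iff]
      intro k hk hk'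
      obtain ⟨hk, -⟩ := mem_permDes.1 hk
      dsimp only at hk'
      omega
    omega
  refine ⟨(⟨fun p => d (w p) - I p, fun p q hpq => ?_⟩, w), funext fun p => ?_⟩
  · have h1 := key p q hpq
    have h2 := hle p
    have h3 := hle q
    dsimp only
    omega
  · rw [← w.apply_symm_apply p, PartPerm.exponent_apply (_, w)]
    exact Nat.add_sub_cancel' (hle _)

/-- The bijection between pairs (partition, permutation) and exponent vectors. -/
noncomputable def PartPerm.exponentEquiv (n : ℕ) : PartPerm n ≃ (Fin n → ℕ) :=
  Equiv.ofBijective PartPerm.exponent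
    ⟨PartPerm.exponent_injective, PartPerm.exponent_surjective⟩

end DescentExponents

section Triangularity

/-- A family which is unitriangular with respect to a basis is linearly independent and
spanning. -/
theorem linearIndependent_and_span_of_triangular {ι F V K : Type*} [Field F] [AddCommGroup V]
    [Module F V] [LinearOrder K] [WellFoundedLT K] (b : Module.Basis ι F V) (f : ι → V)
    (key : ι → K) (h : ∀ i, f i - b i ∈ Submodule.span F (b '' {j | key j < key i})) :
    LinearIndependent F f ∧ Submodule.span F (Set.range f) = ⊤ := by
  classical
  constructor
  · rw [linearIndependent_iff]
    intro c hc
    by_contra hne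
    obtain ⟨i, hi, hmax⟩ := c.support.exists_max_image key (Finsupp.support_nonempty_iff.2 hne)
    have h1 : ∀ j ∈ c.support, b.repr (f j) i = if j = i then 1 else 0 := by
      intro j hj
      have h2 : b.repr (f j - b j) i = 0 := by
        by_contra h3
        have h4 := (b.mem_span_image.1 (h j)) (Finsupp.mem_support_iff.2 h3)
        exact absurd (show key i < key j from h4) (not_lt.2 (hmax j hj))
      rw [map_sub, Finsupp.sub_apply, sub_eq_zero] at h2
      rw [h2, b.repr_self, Finsupp.single_apply]
    have h5 := congrArg (fun v => b.repr v i) hc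
    simp only [Finsupp.linearCombination_apply, Finsupp.sum, map_sum, map_smul,
      Finsupp.finsetSum_apply, Finsupp.smul_apply, map_zero, Finsupp.coe_zero,
      Pi.zero_apply, smul_eq_mul] at h5
    rw [Finset.sum_congr rfl fun j hj => by rw [h1 j hj]] at h5
    simp at h5
    exact Finsupp.mem_support_iff.1 hi h5
  · rw [eq_top_iff, ← b.span_eq, Submodule.span_le]
    rintro _ ⟨i, rfl⟩
    rw [SetLike.mem_coe]
    induction hk : key i using WellFoundedLT.induction generalizing i with
    | _ k ih =>
      have h1 : f i - b i ∈ Submodule.span F (Set.range f) := by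
        refine Submodule.span_le.2 ?_ (h i)
        rintro _ ⟨j, hj, rfl⟩
        exact ih (key j) (hk ▸ hj) j rfl
      rw [← sub_sub_cancel (f i) (b i)]
      exact sub_mem (Submodule.subset_span ⟨i, rfl⟩) h1

variable {n : ℕ}

/-- The pairs of positions at which `d` is weakly decreasing. -/
def weakDescents (d : Fin n → ℕ) : Finset (Fin n × Fin n) :=
  Finset.univ.filter fun p => p.1 < p.2 ∧ d p.2 ≤ d p.1

theorem mem_weakDescents {d : Fin n → ℕ} {p q : Fin n} :
    (p, q) ∈ weakDescents d ↔ p < q ∧ d q ≤ d p := by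
  simp [weakDescents]

/-- The key by which exponent vectors are compared. -/
def expKey (d : Fin n → ℕ) : ℕ ×ₗ ℕ := toLex (maxSum d, (weakDescents d).card)

theorem expKey_lt_of_maxSum_lt {d e : Fin n → ℕ} (h : maxSum d < maxSum e) :
    expKey d < expKey e :=
  Prod.Lex.toLex_lt_toLex.2 (Or.inl h)

/-- The rearrangements of an exponent vector. -/
def rearrangements (μ : Fin n → ℕ) : Finset (Fin n → ℕ) :=
  Finset.univ.image fun σ : Equiv.Perm (Fin n) => μ ∘ σ

theorem mem_rearrangements {μ e : Fin n → ℕ} :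
    e ∈ rearrangements μ ↔ ∃ σ : Equiv.Perm (Fin n), μ ∘ σ = e := by
  simp [rearrangements]

theorem PartPerm.expKey_lt (x : PartPerm n) {e : Fin n → ℕ} (he : e ∈ rearrangements x.1.1)
    (hne : e ≠ x.1.1 ∘ x.2.symm) :
    expKey (expI n (permDes x.2) ∘ x.2.symm + e) < expKey x.exponent := by
  obtain ⟨⟨μ, hμ⟩, w⟩ := x
  obtain ⟨σ, hσ⟩ := mem_rearrangements.1 he
  dsimp only at hσ hne ⊢
  have hI := expI_antitone (n := n) (permDes w)
  set I := expI n (permDes w) with hIdef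
  have hmono : Monovary (I ∘ w.symm) (μ ∘ w.symm) :=
    fun p q h => hI (le_of_not_ge fun h' => not_lt.2 (hμ h') h)
  have hmax : maxSum (exponent (⟨μ, hμ⟩, w)) = maxSum (I ∘ w.symm) + maxSum e := by
    rw [exponent, maxSum_add_of_monovary hmono, ← hσ, maxSum_comp_perm μ, maxSum_comp_perm μ]
  by_cases hme : Monovary (I ∘ w.symm) e
  · refine Prod.Lex.toLex_lt_toLex.2 (Or.inr ⟨?_, Finset.card_lt_card ?_⟩)
    · rw [hmax, maxSum_add_of_monovary hme]
    · have hexp : ∀ p, exponent (⟨μ, hμ⟩, w) p = I (w.symm p) + μ (w.symm p) := fun p => rfl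
      have hsub : weakDescents (I ∘ w.symm + e) ⊆ weakDescents (exponent (⟨μ, hμ⟩, w)) := by
        rintro ⟨p, q⟩ h
        rw [mem_weakDescents] at h ⊢
        refine ⟨h.1, ?_⟩
        by_contra! h'
        rw [hexp, hexp] at h'
        have h1 : w.symm q < w.symm p := by
          by_contra! h1
          have := hI h1
          have := hμ h1
          omega
        have h2 : I (w.symm p) < I (w.symm q) := expI_permDes_lt h1 (by simpa using h.1)
        have h3 : e p ≤ e q := hme.symm h2
        have h4 := h.2
        simp only [Pi.add_apply, Function.comp_apply] at h4
        omega
      refine Finset.ssubset_iff_subset_ne.2 ⟨hsub, fun heq => hne ?_⟩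
      have hanti : Antitone (μ ∘ (σ * w : Equiv.Perm (Fin n))) := by
        intro u v huv
        have hew : ∀ u, (μ ∘ (σ * w : Equiv.Perm (Fin n))) u = e (w u) := fun u => by
          rw [← hσ]; rfl
        rw [hew, hew]
        rcases (hI huv).lt_or_eq with h | h
        · exact hme.symm (by simpa using h)
        · rcases huv.eq_or_lt with rfl | huv
          · exact le_rfl
          have h1 : w u < w v := by
            by_contra! h1
            exact (expI_permDes_lt huv (lt_of_le_of_ne h1 fun e => huv.ne' (w.injective e))).ne h
          have h2 : (w u, w v) ∈ weakDescents (exponent (⟨μ, hμ⟩, w)) := by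
            rw [mem_weakDescents, hexp, hexp, w.symm_apply_apply, w.symm_apply_apply]
            exact ⟨h1, add_le_add h.le (hμ huv.le)⟩
          rw [← heq, mem_weakDescents] at h2
          have h3 := h2.2
          simp only [Pi.add_apply, Function.comp_apply, w.symm_apply_apply] at h3
          omega
      have h5 := Tuple.unique_antitone (τ := 1) hanti (by simpa using hμ)
      rw [← hσ]
      ext p
      simpa using congrFun h5 (w.symm p)
  · refine expKey_lt_of_maxSum_lt ?_
    rw [hmax]
    simp only [Monovary, not_forall, not_le] at hme
    obtain ⟨p, q, h1, h2⟩ := hme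
    exact maxSum_add_lt h2 h1

variable (F : Type*) [Field F]

/-- The monomial symmetric polynomial. -/
noncomputable def monomSymm (μ : Fin n → ℕ) : MvPolynomial (Fin n) F :=
  ∑ e ∈ rearrangements μ, monom F e

variable {F}

theorem PartPerm.monomSymm_mul_sub_mem (x : PartPerm n) {a : MvPolynomial (Fin n) F}
    (ha : a - monom F (expI n (permDes x.2) ∘ x.2.symm)
      ∈ lowSpan F n (maxSum (expI n (permDes x.2)))) :
    monomSymm F x.1.1 * a - monom F x.exponent
      ∈ Submodule.span F (monom F '' {e | expKey e < expKey x.exponent}) := by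
  set I := expI n (permDes x.2) with hIdef
  have hI := expI_antitone (n := n) (permDes x.2)
  have hmono : Monovary (I ∘ x.2.symm) (x.1.1 ∘ x.2.symm) :=
    fun p q h => hI (le_of_not_ge fun h' => not_lt.2 (x.1.2 h') h)
  have h0 : x.1.1 ∘ x.2.symm ∈ rearrangements x.1.1 := mem_rearrangements.2 ⟨_, rfl⟩
  have h1 : monomSymm F x.1.1 * a - monom F x.exponent
      = monomSymm F x.1.1 * (a - monom F (I ∘ x.2.symm))
        + ∑ e ∈ (rearrangements x.1.1).erase (x.1.1 ∘ x.2.symm),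
          monom F (I ∘ x.2.symm + e) := by
    have h2 := Finset.add_sum_erase _ (fun e => monom F (I ∘ x.2.symm + e)) h0
    have h3 : ∑ e ∈ rearrangements x.1.1, monom F (I ∘ x.2.symm + e)
        = monomSymm F x.1.1 * monom F (I ∘ x.2.symm) := by
      rw [monomSymm, Finset.sum_mul]
      exact Finset.sum_congr rfl fun e _ => by rw [monom_add, mul_comm]
    rw [h3] at h2
    rw [PartPerm.exponent, ← hIdef]
    linear_combination -h2
  rw [h1]
  refine add_mem ?_ (Submodule.sum_mem _ fun e he => ?_)
  · rw [monomSymm, Finset.sum_mul]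
    refine Submodule.sum_mem _ fun e he => ?_
    obtain ⟨σ, hσ⟩ := mem_rearrangements.1 he
    refine Submodule.span_mono (Set.image_mono fun d hd => ?_) (monom_mul_mem_lowSpan ha)
    refine expKey_lt_of_maxSum_lt (lt_of_lt_of_eq hd ?_)
    rw [PartPerm.exponent, maxSum_add_of_monovary hmono, ← hσ, maxSum_comp_perm,
      maxSum_comp_perm, maxSum_comp_perm, add_comm]
  · rw [Finset.mem_erase] at he
    exact Submodule.subset_span ⟨_, x.expKey_lt he.2 he.1, rfl⟩

theorem PartPerm.linearIndependent_and_span {a : Equiv.Perm (Fin n) → MvPolynomial (Fin n) F}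
    (ha : ∀ w, a w - monom F (expI n (permDes w) ∘ w.symm)
      ∈ lowSpan F n (maxSum (expI n (permDes w)))) :
    LinearIndependent F (fun x : PartPerm n => monomSymm F x.1.1 * a x.2) ∧
      Submodule.span F (Set.range fun x : PartPerm n => monomSymm F x.1.1 * a x.2) = ⊤ := by
  have hb : ⇑((monomBasis F n).reindex (exponentEquiv n).symm) = fun x => monom F x.exponent := by
    ext1 x
    rw [Module.Basis.reindex_apply, monomBasis_apply]
    rfl
  refine linearIndependent_and_span_of_triangular
    ((monomBasis F n).reindex (exponentEquiv n).symm) _ (fun x => expKey x.exponent) fun x => ?_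
  rw [hb]
  refine Submodule.span_mono ?_ (x.monomSymm_mul_sub_mem (ha x.2))
  rintro _ ⟨e, he, rfl⟩
  obtain ⟨y, rfl⟩ := exponent_surjective e
  exact ⟨y, he, rfl⟩

end Triangularity

section Symmetric

variable {n : ℕ} {F : Type*} [Field F]

theorem comp_mem_rearrangements {μ e : Fin n → ℕ} (h : e ∈ rearrangements μ)
    (σ : Equiv.Perm (Fin n)) : e ∘ σ ∈ rearrangements μ := by
  obtain ⟨τ, rfl⟩ := mem_rearrangements.1 h
  exact mem_rearrangements.2 ⟨τ * σ, rfl⟩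

theorem monomSymm_isSymmetric (μ : Fin n → ℕ) : (monomSymm F μ).IsSymmetric := by
  intro σ
  rw [monomSymm, map_sum]
  refine Finset.sum_nbij' (fun e => e ∘ σ.symm) (fun e => e ∘ σ)
    (fun e he => comp_mem_rearrangements he _) (fun e he => comp_mem_rearrangements he _)
    (fun e _ => ?_) (fun e _ => ?_) fun e _ => rename_monom F σ e
  · ext; simp
  · ext; simp

theorem monomSymm_zero : monomSymm F (0 : Fin n → ℕ) = 1 := by
  have h : rearrangements (0 : Fin n → ℕ) = {0} := by
    ext e
    rw [mem_rearrangements, Finset.mem_singleton]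
    exact ⟨fun ⟨_, h⟩ => h.symm, fun h => ⟨1, h.symm⟩⟩
  rw [monomSymm, h, Finset.sum_singleton, monom_zero]

theorem constantCoeff_monomSymm {μ : Fin n → ℕ} (hμ : μ ≠ 0) :
    constantCoeff (monomSymm F μ) = 0 := by
  rw [monomSymm, map_sum]
  refine Finset.sum_eq_zero fun e he => ?_
  obtain ⟨σ, rfl⟩ := mem_rearrangements.1 he
  obtain ⟨j, hj⟩ := Function.ne_iff.1 hμ
  rw [monom, map_prod]
  refine Finset.prod_eq_zero (Finset.mem_univ (σ.symm j)) ?_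
  simp only [Function.comp_apply, Equiv.apply_symm_apply, map_pow, constantCoeff_X]
  exact zero_pow hj

theorem monomBasis_repr_rename (σ : Equiv.Perm (Fin n)) (f : MvPolynomial (Fin n) F)
    (d : Fin n → ℕ) : (monomBasis F n).repr (rename σ f) d = (monomBasis F n).repr f (d ∘ σ) := by
  have h : (Finsupp.lapply d ∘ₗ (monomBasis F n).repr.toLinearMap) ∘ₗ (rename σ).toLinearMap
      = Finsupp.lapply (d ∘ σ) ∘ₗ (monomBasis F n).repr.toLinearMap := by
    refine (monomBasis F n).ext fun e => ?_
    simp only [LinearMap.comp_apply, LinearEquiv.coe_coe, AlgHom.toLinearMap_apply,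
      Finsupp.lapply_apply, Module.Basis.repr_self]
    rw [monomBasis_apply, rename_monom, ← monomBasis_apply, Module.Basis.repr_self,
      Finsupp.single_apply, Finsupp.single_apply]
    congr 1
    rw [eq_iff_iff]
    constructor
    · rintro rfl
      ext; simp
    · rintro rfl
      ext; simp
  exact LinearMap.congr_fun h f

theorem monomBasis_repr_zero (f : MvPolynomial (Fin n) F) :
    (monomBasis F n).repr f 0 = constantCoeff f := by
  rw [monomBasis, Module.Basis.repr_reindex_apply, constantCoeff_eq,
    show Finsupp.equivFunOnFinite.symm (0 : Fin n → ℕ) = 0 from Finsupp.ext fun _ => rfl]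
  rfl

theorem exists_antitone_comp (d : Fin n → ℕ) : ∃ σ : Equiv.Perm (Fin n), Antitone (d ∘ σ) :=
  ⟨_, Tuple.monotone_sort (OrderDual.toDual ∘ d)⟩

theorem mem_span_monomSymm_of_isSymmetric {s : MvPolynomial (Fin n) F}
    (hs : s.IsSymmetric) (h0 : constantCoeff s = 0) :
    s ∈ Submodule.span F (monomSymm F '' {μ : Fin n → ℕ | Antitone μ ∧ μ ≠ 0}) := by
  classical
  set b := monomBasis F n
  have hc : ∀ d (σ : Equiv.Perm (Fin n)), b.repr s (d ∘ σ) = b.repr s d := fun d σ => by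
    rw [← monomBasis_repr_rename, hs σ]
  have key : s = ∑ μ ∈ (b.repr s).support.filter (fun μ => Antitone μ),
      b.repr s μ • monomSymm F μ := by
    conv_lhs => rw [← b.linearCombination_repr s, Finsupp.linearCombination_apply, Finsupp.sum]
    simp only [monomSymm, Finset.smul_sum]
    rw [Finset.sum_sigma']
    symm
    refine Finset.sum_bij (fun x _ => x.2) ?_ ?_ ?_ ?_
    · rintro ⟨μ, e⟩ h
      obtain ⟨h1, h2⟩ := Finset.mem_sigma.1 h
      dsimp only at h1 h2 ⊢
      obtain ⟨σ, rfl⟩ := mem_rearrangements.1 h2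
      rw [Finsupp.mem_support_iff, hc]
      exact Finsupp.mem_support_iff.1 (Finset.mem_filter.1 h1).1
    · rintro ⟨μ, e⟩ h ⟨μ', e'⟩ h' (rfl : e = e')
      obtain ⟨h1, h2⟩ := Finset.mem_sigma.1 h
      obtain ⟨h1', h2'⟩ := Finset.mem_sigma.1 h'
      obtain ⟨σ, hσ⟩ := mem_rearrangements.1 h2
      obtain ⟨σ', hσ'⟩ := mem_rearrangements.1 h2'
      dsimp only at hσ hσ' h1 h1'
      have ha := (Finset.mem_filter.1 h1).2
      have ha' := (Finset.mem_filter.1 h1').2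
      have h3 : μ = μ' ∘ (σ' * σ⁻¹ : Equiv.Perm (Fin n)) := by
        have := hσ.trans hσ'.symm
        ext p
        simpa using congrFun this (σ⁻¹ p)
      have h4 := Tuple.unique_antitone (τ := 1) (f := μ') (h3 ▸ ha) (by simpa using ha')
      rw [← h3] at h4
      obtain rfl : μ = μ' := by simpa using h4
      rfl
    · intro e he
      obtain ⟨σ, hσ⟩ := exists_antitone_comp e
      refine ⟨⟨e ∘ σ, e⟩, Finset.mem_sigma.2 ⟨Finset.mem_filter.2 ⟨?_, hσ⟩, ?_⟩, rfl⟩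
      · rw [Finsupp.mem_support_iff, hc]
        exact Finsupp.mem_support_iff.1 he
      · exact mem_rearrangements.2 ⟨σ⁻¹, by ext; simp⟩
    · rintro ⟨μ, e⟩ h
      obtain ⟨h1, h2⟩ := Finset.mem_sigma.1 h
      dsimp only at h1 h2 ⊢
      obtain ⟨σ, rfl⟩ := mem_rearrangements.1 h2
      rw [hc, monomBasis_apply]
  rw [key]
  refine Submodule.sum_mem _ fun μ hμ => Submodule.smul_mem _ _ (Submodule.subset_span
    ⟨μ, ⟨(Finset.mem_filter.1 hμ).2, ?_⟩, rfl⟩)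
  rintro rfl
  refine Finsupp.mem_support_iff.1 (Finset.mem_filter.1 hμ).1 ?_
  rw [monomBasis_repr_zero, h0]

end Symmetric

section Coinvariants

variable {n : ℕ} {F : Type*} [Field F]

/-- The family `m_μ a_w`, where `μ` runs over partitions and `w` over permutations. -/
noncomputable def PartPerm.poly (a : Equiv.Perm (Fin n) → MvPolynomial (Fin n) F)
    (x : PartPerm n) : MvPolynomial (Fin n) F :=
  monomSymm F x.1.1 * a x.2

variable {a : Equiv.Perm (Fin n) → MvPolynomial (Fin n) F}

theorem symmetric_mul_mem_span (hspan : Submodule.span F (Set.range (PartPerm.poly a)) = ⊤)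
    {s : MvPolynomial (Fin n) F} (hs : s.IsSymmetric) (h0 : constantCoeff s = 0)
    (g : MvPolynomial (Fin n) F) :
    s * g ∈ Submodule.span F (PartPerm.poly a '' {x | x.1.1 ≠ 0}) := by
  have hg : g ∈ Submodule.span F (Set.range (PartPerm.poly a)) := hspan ▸ Submodule.mem_top
  induction hg using Submodule.span_induction with
  | mem g hg =>
    obtain ⟨x, rfl⟩ := hg
    have h1 := mem_span_monomSymm_of_isSymmetric
      (hs.mul (monomSymm_isSymmetric x.1.1)) (by rw [map_mul, h0, zero_mul])
    rw [PartPerm.poly, ← mul_assoc]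
    generalize s * monomSymm F x.1.1 = t at h1
    induction h1 using Submodule.span_induction with
    | mem t ht =>
      obtain ⟨ρ, ⟨hρ, hρ0⟩, rfl⟩ := ht
      exact Submodule.subset_span ⟨(⟨ρ, hρ⟩, x.2), hρ0, rfl⟩
    | zero => rw [zero_mul]; exact zero_mem _
    | add t t' _ _ h h' => rw [add_mul]; exact add_mem h h'
    | smul c t _ h => rw [smul_mul_assoc]; exact Submodule.smul_mem _ c h
  | zero => rw [mul_zero]; exact zero_mem _
  | add g g' _ _ h h' => rw [mul_add]; exact add_mem h h'
  | smul c g _ h => rw [mul_smul_comm]; exact Submodule.smul_mem _ c h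

theorem coinvIdeal_eq_span (hspan : Submodule.span F (Set.range (PartPerm.poly a)) = ⊤) :
    (coinvIdeal n F).restrictScalars F
      = Submodule.span F (PartPerm.poly a '' {x | x.1.1 ≠ 0}) := by
  apply le_antisymm
  · intro f hf
    rw [Submodule.restrictScalars_mem, coinvIdeal] at hf
    induction hf using Submodule.span_induction with
    | mem s hs => simpa using symmetric_mul_mem_span hspan hs.1 hs.2 1
    | zero => exact zero_mem _
    | add f g _ _ h h' => exact add_mem h h'
    | smul r f hf h =>
      clear hf
      induction h using Submodule.span_induction with
      | mem f hf =>
        obtain ⟨x, hx, rfl⟩ := hf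
        rw [smul_eq_mul, mul_comm, PartPerm.poly, mul_assoc]
        exact symmetric_mul_mem_span hspan (monomSymm_isSymmetric _)
          (constantCoeff_monomSymm hx) _
      | zero => rw [smul_zero]; exact zero_mem _
      | add f g _ _ h h' => rw [smul_add]; exact add_mem h h'
      | smul c f _ h => rw [smul_comm]; exact Submodule.smul_mem _ c h
  · rw [Submodule.span_le]
    rintro _ ⟨x, hx, rfl⟩
    exact Ideal.mul_mem_right _ _ (Ideal.subset_span
      ⟨monomSymm_isSymmetric _, constantCoeff_monomSymm hx⟩)

theorem PartPerm.poly_zero (w : Equiv.Perm (Fin n)) :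
    poly a (⟨0, antitone_const⟩, w) = a w := by
  rw [poly, monomSymm_zero, one_mul]

theorem linearIndependent_mk (hli : LinearIndependent F (PartPerm.poly a))
    (hspan : Submodule.span F (Set.range (PartPerm.poly a)) = ⊤) :
    LinearIndependent F fun w => Ideal.Quotient.mk (coinvIdeal n F) (a w) := by
  have h1 : LinearIndependent F a := by
    have h2 := hli.comp (fun w : Equiv.Perm (Fin n) => (⟨0, antitone_const⟩, w))
      fun w w' h => congrArg Prod.snd h
    simpa only [Function.comp_def, PartPerm.poly_zero] using h2
  refine h1.map (f := (Ideal.Quotient.mkₐ F (coinvIdeal n F)).toLinearMap) ?_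
  have h3 : LinearMap.ker (Ideal.Quotient.mkₐ F (coinvIdeal n F)).toLinearMap
      = (coinvIdeal n F).restrictScalars F := by
    ext f
    simp [Ideal.Quotient.eq_zero_iff_mem]
  rw [h3, coinvIdeal_eq_span hspan]
  have h4 : Set.range a = PartPerm.poly a '' {x | x.1.1 = 0} := by
    ext f
    constructor
    · rintro ⟨w, rfl⟩
      exact ⟨(⟨0, antitone_const⟩, w), rfl, PartPerm.poly_zero w⟩
    · rintro ⟨⟨⟨μ, hμ⟩, w⟩, rfl, rfl⟩
      exact ⟨w, (PartPerm.poly_zero w).symm⟩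
  rw [h4]
  exact hli.disjoint_span_image (Set.disjoint_left.2 fun x h h' => h' h)

theorem span_range_mk (hspan : Submodule.span F (Set.range (PartPerm.poly a)) = ⊤) :
    Submodule.span F (Set.range fun w => Ideal.Quotient.mk (coinvIdeal n F) (a w)) = ⊤ := by
  rw [eq_top_iff]
  rintro f -
  obtain ⟨f, rfl⟩ := Ideal.Quotient.mk_surjective f
  have hf : f ∈ Submodule.span F (Set.range (PartPerm.poly a)) := hspan ▸ Submodule.mem_top
  induction hf using Submodule.span_induction with
  | mem f hf =>
    obtain ⟨x, rfl⟩ := hf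
    by_cases hx : x.1.1 = 0
    · obtain ⟨⟨μ, hμ⟩, w⟩ := x
      obtain rfl : μ = 0 := hx
      rw [PartPerm.poly_zero]
      exact Submodule.subset_span ⟨w, rfl⟩
    · have h1 : PartPerm.poly a x ∈ (coinvIdeal n F).restrictScalars F :=
        coinvIdeal_eq_span hspan ▸ Submodule.subset_span ⟨x, hx, rfl⟩
      rw [Ideal.Quotient.eq_zero_iff_mem.2 h1]
      exact zero_mem _
  | zero => rw [map_zero]; exact zero_mem _
  | add f g _ _ h h' => rw [map_add]; exact add_mem h h'
  | smul c f _ h => exact Submodule.smul_mem _ c h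

end Coinvariants

section AtomAction

variable {n : ℕ} {F : Type*} [Field F]
  {T : ℕ → MvPolynomial (Fin n) F → MvPolynomial (Fin n) F}
  {a : Equiv.Perm (Fin n) → MvPolynomial (Fin n) F}

theorem permDes_sw_mul {i : ℕ} {hi : i + 1 < n} {w : Equiv.Perm (Fin n)}
    (h : IsLeftAscent w hi)
    (h' : (w.symm ⟨i + 1, hi⟩ : ℕ) ≠ w.symm ⟨i, Nat.lt_of_succ_lt hi⟩ + 1) :
    permDes (sw n i * w) = permDes w := by
  ext k
  rw [mem_permDes, mem_permDes]
  refine exists_congr fun hk => ?_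
  rw [sw_mul_lt_iff h (Nat.lt_succ_self k)]
  refine or_iff_right ?_
  rintro ⟨h1, h2⟩
  exact h' (by rw [← h1, ← h2])

theorem rename_sw_monom_expI {I : Finset ℕ} {j : ℕ} (hj : j + 1 < n) (h : j ∉ I) :
    rename (sw n j) (monom F (expI n I)) = monom F (expI n I) := by
  have h1 := expI_succ (n := n) I hj
  rw [if_neg h, add_zero] at h1
  rw [rename_monom]
  congr 1
  ext ⟨k, hk⟩
  rw [Function.comp_apply, sw_symm_apply]
  by_cases h2 : k = j
  · subst h2
    rw [sw_apply_self hj, h1]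
  by_cases h3 : k = j + 1
  · subst h3
    rw [sw_apply_succ hj, h1]
  rw [sw_apply_of_ne hj hk h2 h3]

/-- `a w` is the Demazure atom `π̄_w(x_{D(w)})`. -/
def IsDescentAtom (T : ℕ → MvPolynomial (Fin n) F → MvPolynomial (Fin n) F)
    (a : Equiv.Perm (Fin n) → MvPolynomial (Fin n) F) : Prop :=
  ∀ w, ∃ l, IsReducedWord l w ∧ a w = l.foldr T (monom F (expI n (permDes w)))

theorem IsDescentAtom.eq_foldr (hT : IsAtomOperator T) (ha : IsDescentAtom T a) {l : List ℕ}
    {w : Equiv.Perm (Fin n)} (hl : IsReducedWord l w) :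
    a w = l.foldr T (monom F (expI n (permDes w))) := by
  obtain ⟨l', hl', h⟩ := ha w
  rw [h, hT.foldr_eq hl' hl]

theorem IsDescentAtom.apply (hT : IsAtomOperator T) (ha : IsDescentAtom T a) {i : ℕ}
    (hi : i + 1 < n) (w : Equiv.Perm (Fin n)) :
    T i (a w) = -a w ∨ T i (a w) = 0 ∨
      permDes (sw n i * w) = permDes w ∧ T i (a w) = a (sw n i * w) := by
  by_cases h : IsLeftAscent w hi
  · right
    obtain ⟨l, hl⟩ := IsReducedWord.exists_word w
    by_cases h' : (w.symm ⟨i + 1, hi⟩ : ℕ) = w.symm ⟨i, Nat.lt_of_succ_lt hi⟩ + 1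
    · left
      obtain ⟨j, hj, hp⟩ : ∃ (j : ℕ) (hj : j < n), w.symm ⟨i, Nat.lt_of_succ_lt hi⟩ = ⟨j, hj⟩ :=
        ⟨_, Fin.isLt _, rfl⟩
      have hj1 : j + 1 < n := by
        rw [hp] at h'
        exact h' ▸ Fin.isLt _
      have hq : w.symm ⟨i + 1, hi⟩ = ⟨j + 1, hj1⟩ := Fin.ext (by rw [h', hp])
      rw [Equiv.symm_apply_eq] at hp hq
      have hsw : sw n i * w = w * sw n j := by
        rw [sw, dif_pos hi, sw, dif_pos hj1, Equiv.mul_swap_eq_swap_mul, ← hp, ← hq]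
      have hjw : j ∉ permDes w := by
        rw [mem_permDes]
        rintro ⟨_, h3⟩
        rw [← hp, ← hq, Fin.lt_def] at h3
        exact absurd h3 (by simp)
      have h1 : IsReducedWord (l ++ [j]) (sw n i * w) := by
        refine ⟨?_, ?_, ?_⟩
        · intro k hk
          rcases List.mem_append.1 hk with hk | hk
          · exact hl.lt k hk
          · rwa [List.mem_singleton.1 hk]
        · rw [List.map_append, List.prod_append, hl.prod_eq, hsw]
          simp
        · rw [List.length_append, hl.length_eq, invNum_sw_mul h]
          rfl
      have h2 : ∀ m : List ℕ, (∀ k ∈ m, k + 1 < n) → m.foldr T 0 = 0 := by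
        intro m hm
        induction m with
        | nil => rfl
        | cons k m ih =>
          rw [List.foldr_cons, ih fun k' hk' => hm k' (List.mem_cons_of_mem _ hk'),
            hT.apply_eq_zero (hm k (List.mem_cons_self ..)) (map_zero _)]
      rw [ha.eq_foldr hT hl, ← List.foldr_cons (f := T), hT.foldr_eq (hl.cons h) h1, List.foldr_append,
        List.foldr_cons, List.foldr_nil, hT.apply_eq_zero hj1 (rename_sw_monom_expI hj1 hjw),
        h2 l hl.lt]
    · right
      have h1 := permDes_sw_mul h h'
      refine ⟨h1, ?_⟩
      rw [ha.eq_foldr hT hl, ha.eq_foldr hT (hl.cons h), h1, List.foldr_cons]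
  · left
    obtain ⟨l, hl⟩ := IsReducedWord.exists_word (sw n i * w)
    rw [ha.eq_foldr hT (hl.cons' h), List.foldr_cons, hT.apply_apply hi]

theorem IsAtomOperator.apply_mem_coinvIdeal (hT : IsAtomOperator T) {i : ℕ} (hi : i + 1 < n)
    {f : MvPolynomial (Fin n) F} (hf : f ∈ coinvIdeal n F) : T i f ∈ coinvIdeal n F := by
  suffices ∀ r, T i (r * f) ∈ coinvIdeal n F by simpa using this 1
  unfold coinvIdeal at hf
  induction hf using Submodule.span_induction with
  | mem s hs =>
    intro r
    rw [mul_comm, hT.map_mul hi (hs.1 _)]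
    exact Ideal.mul_mem_right _ _ (Ideal.subset_span hs)
  | zero =>
    intro r
    rw [mul_zero, hT.apply_eq_zero hi (map_zero _)]
    exact zero_mem _
  | add f g _ _ h h' =>
    intro r
    rw [mul_add, hT.map_add hi]
    exact add_mem (h r) (h' r)
  | smul c f _ h =>
    intro r
    rw [smul_eq_mul, ← mul_assoc]
    exact h _

theorem IsDescentAtom.apply_mem_span (hT : IsAtomOperator T) (ha : IsDescentAtom T a) {i : ℕ}
    (hi : i + 1 < n) (I : Finset ℕ) {f : MvPolynomial (Fin n) F}
    (hf : Ideal.Quotient.mk (coinvIdeal n F) f ∈ Submodule.span F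
      ((fun w => Ideal.Quotient.mk (coinvIdeal n F) (a w)) '' {w | permDes w = I})) :
    Ideal.Quotient.mk (coinvIdeal n F) (T i f) ∈ Submodule.span F
      ((fun w => Ideal.Quotient.mk (coinvIdeal n F) (a w)) '' {w | permDes w = I}) := by
  set V := Submodule.span F
    ((fun w => Ideal.Quotient.mk (coinvIdeal n F) (a w)) '' {w | permDes w = I}) with hV
  set q := (Ideal.Quotient.mkₐ F (coinvIdeal n F)).toLinearMap
  have h1 : V = (Submodule.span F (a '' {w | permDes w = I})).map q := by
    rw [hV, Submodule.map_span, Set.image_image]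
    rfl
  have h2 : f ∈ V.comap q := hf
  rw [h1, Submodule.comap_map_eq] at h2
  suffices h3 : Submodule.span F (a '' {w | permDes w = I}) ⊔ LinearMap.ker q
      ≤ V.comap (q ∘ₗ hT.toLinearMap hi) from h3 h2
  refine sup_le (Submodule.span_le.2 ?_) fun g hg => ?_
  · rintro _ ⟨w, hw, rfl⟩
    have h3 : ∀ w, permDes w = I → q (a w) ∈ V := fun w hw => Submodule.subset_span ⟨w, hw, rfl⟩
    change q (T i (a w)) ∈ V
    rcases ha.apply hT hi w with h | h | ⟨h, h'⟩
    · rw [h, map_neg]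
      exact neg_mem (h3 w hw)
    · rw [h, map_zero]
      exact zero_mem _
    · rw [h']
      exact h3 _ (h.trans hw)
  · have h3 : q (T i g) = 0 := Ideal.Quotient.eq_zero_iff_mem.2
      (hT.apply_mem_coinvIdeal hi (Ideal.Quotient.eq_zero_iff_mem.1 hg))
    change q (T i g) ∈ V
    rw [h3]
    exact zero_mem _

end AtomAction

section CompositionDescents

variable {n : ℕ}

theorem mem_compositionAsSetEquiv (c : Composition n) (i : Fin (n - 1)) :
    i ∈ compositionAsSetEquiv n (compositionEquiv n c) ↔ ∃ j ≤ c.length, c.sizeUpTo j = i + 1 := by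
  simp only [compositionAsSetEquiv, compositionEquiv, Equiv.coe_fn_mk, Set.mem_toFinset,
    Set.mem_ofPred_eq, Composition.toCompositionAsSet_boundaries, Composition.boundaries,
    Finset.mem_map, Finset.mem_univ, true_and]
  constructor
  · rintro ⟨j, hj⟩
    exact ⟨j, Nat.le_of_lt_succ j.2, (congrArg Fin.val hj).trans (add_comm _ _)⟩
  · rintro ⟨j, hj, h⟩
    exact ⟨⟨j, Nat.lt_succ_of_le hj⟩, Fin.ext (h.trans (add_comm _ _))⟩

theorem compDes_eq (c : Composition n) :
    compDes c = (compositionAsSetEquiv n (compositionEquiv n c)).map Fin.valEmbedding := by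
  ext k
  simp only [compDes, Finset.mem_map, Finset.mem_image, Finset.mem_range,
    mem_compositionAsSetEquiv, Fin.valEmbedding_apply]
  constructor
  · rintro ⟨j, hj, rfl⟩
    have h1 := c.sizeUpTo_strict_mono (i := j) (by omega)
    have h2 := c.sizeUpTo_strict_mono (i := j + 1) (by omega)
    have h3 := c.sizeUpTo_le (j + 1 + 1)
    exact ⟨⟨c.sizeUpTo (j + 1) - 1, by omega⟩, ⟨j + 1, by omega, by dsimp only; omega⟩, rfl⟩
  · rintro ⟨i, ⟨j, hj, h⟩, rfl⟩
    have hi := i.2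
    rcases hj.eq_or_lt with rfl | hj
    · rw [c.sizeUpTo_length] at h
      omega
    cases j with
    | zero =>
      rw [c.sizeUpTo_zero] at h
      omega
    | succ j => exact ⟨j, by omega, by omega⟩

theorem compDes_injective : Function.Injective (compDes (n := n)) := by
  intro c c' h
  rw [compDes_eq, compDes_eq] at h
  exact (compositionEquiv n).injective
    ((compositionAsSetEquiv n).injective (Finset.map_injective _ h))

theorem exists_compDes_eq_permDes (w : Equiv.Perm (Fin n)) :
    ∃ c : Composition n, compDes c = permDes w := by
  obtain ⟨c, hc⟩ := ((compositionEquiv n).trans (compositionAsSetEquiv n)).surjective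
    (Finset.univ.filter fun i => (i : ℕ) ∈ permDes w)
  refine ⟨c, ?_⟩
  rw [compDes_eq, show compositionAsSetEquiv n (compositionEquiv n c) = _ from hc]
  ext k
  simp only [Finset.mem_map, Finset.mem_filter, Finset.mem_univ, true_and, Fin.valEmbedding_apply]
  constructor
  · rintro ⟨i, hi, rfl⟩
    exact hi
  · intro hk
    obtain ⟨hk', -⟩ := mem_permDes.1 hk
    exact ⟨⟨k, by omega⟩, hk, rfl⟩

end CompositionDescents

/-- **The decomposition of Theorem 4.4.**  For each composition `α ⊨ n` let `M_α` be the
subspace of the coinvariant algebra spanned by the images of the Demazure atoms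
`π̄_w(x_{D(α)})` with `D(w) = D(α)` (here `a w = π̄_w(x_{D(w)})`, computed from any reduced
word of `w`, with `π_i` characterized by `(x_i - x_{i+1}) π_i f = x_i f - x_{i+1} s_i(f)`
and `π̄_i = π_i - 1`).  Then those images form an `F`-basis of `M_α`, each `M_α` is
invariant under the induced operators `π̄_i`, and the coinvariant algebra is `⨁_α M_α`. -/
theorem stmt_8 (n : ℕ) (hn : 1 ≤ n) (F : Type*) [Field F]
    (dem : ℕ → MvPolynomial (Fin n) F → MvPolynomial (Fin n) F)
    (hdem : ∀ (i : ℕ) (hi : i + 1 < n) (f : MvPolynomial (Fin n) F),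
      (X (⟨i, Nat.lt_of_succ_lt hi⟩ : Fin n) - X ⟨i + 1, hi⟩) * dem i f
        = X (⟨i, Nat.lt_of_succ_lt hi⟩ : Fin n) * f - X ⟨i + 1, hi⟩ * rename (sw n i) f)
    (a : Equiv.Perm (Fin n) → MvPolynomial (Fin n) F)
    (ha : ∀ w : Equiv.Perm (Fin n), ∃ l : List ℕ,
      (∀ i ∈ l, i + 1 < n) ∧ (l.map (sw n)).prod = w ∧ l.length = invNum w ∧
      a w = l.foldr (fun i f => dem i f - f) (xI F n (permDes w)))
    (M : Composition n → Submodule F (MvPolynomial (Fin n) F ⧸ coinvIdeal n F))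
    (hM : ∀ α : Composition n, M α = Submodule.span F
      ((fun w => Ideal.Quotient.mk (coinvIdeal n F) (a w)) ''
        {w : Equiv.Perm (Fin n) | permDes w = compDes α})) :
    (∀ α : Composition n,
      LinearIndependent F (fun w : {w : Equiv.Perm (Fin n) // permDes w = compDes α} =>
        Ideal.Quotient.mk (coinvIdeal n F) (a w.val))) ∧
    (∀ (α : Composition n) (i : ℕ), i + 1 < n →
      ∀ f : MvPolynomial (Fin n) F, Ideal.Quotient.mk (coinvIdeal n F) f ∈ M α →
        Ideal.Quotient.mk (coinvIdeal n F) (dem i f - f) ∈ M α) ∧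
    iSupIndep M ∧ (⨆ α : Composition n, M α) = ⊤ := by
  have hT : IsAtomOperator fun i f => dem i f - f := fun i hi f => by
    rw [mul_sub, hdem i hi]
    ring
  have ha' : IsDescentAtom (fun i f => dem i f - f) a := fun w => by
    obtain ⟨l, h1, h2, h3, h4⟩ := ha w
    exact ⟨l, ⟨h1, h2, h3⟩, h4⟩
  obtain ⟨hli, hspan⟩ := PartPerm.linearIndependent_and_span (a := a) fun w => by
    obtain ⟨l, hl⟩ := IsReducedWord.exists_word w
    rw [ha'.eq_foldr hT hl]
    exact hT.foldr_monom_sub_mem hl fun p q hpq h => expI_permDes_lt hpq h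
  have hli' := linearIndependent_mk hli hspan
  refine ⟨fun α => hli'.comp _ Subtype.val_injective, fun α i hi f hf => ?_, fun α => ?_, ?_⟩
  · rw [hM] at hf ⊢
    exact ha'.apply_mem_span hT hi _ hf
  · rw [hM]
    refine Disjoint.mono_right (iSup₂_le fun β hβ => ?_) (hli'.disjoint_span_image
      (t := {w | permDes w ≠ compDes α}) (Set.disjoint_left.2 fun w h h' => h' h))
    rw [hM]
    refine Submodule.span_mono (Set.image_mono fun w hw h => hβ (compDes_injective ?_))
    exact (show permDes w = compDes β from hw).symm.trans h
  · rw [eq_top_iff, ← span_range_mk hspan, Submodule.span_le]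
    rintro _ ⟨w, rfl⟩
    obtain ⟨α, hα⟩ := exists_compDes_eq_permDes w
    refine (le_iSup M α) ?_
    rw [hM]
    exact Submodule.subset_span ⟨w, hα.symm, rfl⟩
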